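/- Let T ≥ 1, let β ∈ (0,1], let π_0 be the uniform policy (π_0(a|s) = 1/|A| for all (s,a)), let Q_1, …, Q_T ∈ ℝ^{S×A} be arbitrary, and for t = 0, …, T−1 let π_{t+1} be the NPG update of π_t with respect to Q_{t+1} and stepsize β. Then for any policy π* and any probability distribution μ on S: V^{π*}(μ) − max_{0 ≤ t ≤ T−1} V^{π_t}(μ) ≤ log(e|A|)/((1−γ)² β T) + (4/((1−γ)² T)) Σ_{t=0}^{T−1} ‖Q^{π_t} − Q_{t+1}‖∞. -/

import Mathlib

noncomputable def supNorm {I : Type*} [Fintype I] [Nonempty I] (f : I → ℝ) : ℝ :=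
  Finset.univ.sup' Finset.univ_nonempty (fun i => |f i|)

noncomputable def matNorm {I : Type*} [Fintype I] [Nonempty I] (M : Matrix I I ℝ) : ℝ :=
  supNorm (fun i => ∑ j, |M i j|)

/-- `π` is a policy: for each state `s`, `π s` is a probability distribution on actions. -/
def IsPolicy {S A : Type*} [Fintype A] (π : S → A → ℝ) : Prop :=
  (∀ s a, 0 ≤ π s a) ∧ ∀ s, ∑ a, π s a = 1

/-- A row-stochastic matrix. -/
def IsStochastic {S : Type*} [Fintype S] (P : Matrix S S ℝ) : Prop :=
  (∀ s s', 0 ≤ P s s') ∧ ∀ s, ∑ s', P s s' = 1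

/-- The state-action transition matrix `P_π((s,a),(s',a')) = P_a(s,s') π(a'|s')`. -/
def Psa {S A : Type*} (P : A → Matrix S S ℝ) (π : S → A → ℝ) :
    Matrix (S × A) (S × A) ℝ :=
  Matrix.of fun p q => P p.2 p.1 q.1 * π q.1 q.2

/-- The truncated policy `π_ρ̄(a|s) = min(ρ̄ π_b(a|s), π(a|s)) / Σ_{a'} min(ρ̄ π_b(a'|s), π(a'|s))`. -/
noncomputable def truncPolicy {S A : Type*} [Fintype A] (πb π : S → A → ℝ) (ρ : ℝ) :
    S → A → ℝ :=
  fun s a => min (ρ * πb s a) (π s a) / ∑ a', min (ρ * πb s a') (π s a')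

/-- The diagonal matrix with `D_π((s,a),(s,a)) = Σ_{a'} min(ρ̄ π_b(a'|s), π(a'|s))`. -/
noncomputable def truncDiag {S A : Type*} [Fintype A] [DecidableEq S] [DecidableEq A]
    (πb π : S → A → ℝ) (ρ : ℝ) : Matrix (S × A) (S × A) ℝ :=
  Matrix.diagonal (fun p => ∑ a', min (ρ * πb p.1 a') (π p.1 a'))

/-- The NPG update of policy `π` with respect to `Q̂` and stepsize `β`. -/
noncomputable def npg {S A : Type*} [Fintype A] (π : S → A → ℝ) (β : ℝ)
    (Qh : S × A → ℝ) : S → A → ℝ :=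
  fun s a => π s a * Real.exp (β * Qh (s, a)) / ∑ a', π s a' * Real.exp (β * Qh (s, a'))

/-- The induced state transition matrix `P̃_π(s,s') = Σ_a π(a|s) P_a(s,s')`. -/
noncomputable def PtildeGen {S A : Type*} [Fintype A] (P : A → Matrix S S ℝ)
    (π : S → A → ℝ) : Matrix S S ℝ :=
  Matrix.of fun s s' => ∑ a, π s a * P a s s'

/-- The discounted state visitation distribution
`d_μ^π(s) = (1−γ) Σ_{j=0}^∞ γ^j (μᵀ P̃_π^j)(s)`. -/
noncomputable def dvisit {S A : Type*} [Fintype S] [Fintype A] [DecidableEq S]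
    (P : A → Matrix S S ℝ) (π : S → A → ℝ) (γ : ℝ) (μ : S → ℝ) : S → ℝ :=
  fun s => (1 - γ) * ∑' j : ℕ, γ ^ j * Matrix.vecMul μ (PtildeGen P π ^ j) s

/-- KL divergence `Σ_a p(a) log(p(a)/q(a))` between distributions on actions. -/
noncomputable def klA {A : Type*} [Fintype A] (p q : A → ℝ) : ℝ :=
  ∑ a, p a * Real.log (p a / q a)

/-- The value function `V(s) = Σ_a π(a|s) Q(s,a)`. -/
def stateValue {S A : Type*} [Fintype A] (π : S → A → ℝ) (Q : S × A → ℝ) (s : S) : ℝ :=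
  ∑ a, π s a * Q (s, a)

lemma abs_le_supNorm {I : Type*} [Fintype I] [Nonempty I] (f : I → ℝ) (i : I) :
    |f i| ≤ supNorm f :=
  Finset.le_sup' (fun i => |f i|) (Finset.mem_univ i)

lemma supNorm_nonneg {I : Type*} [Fintype I] [Nonempty I] (f : I → ℝ) : 0 ≤ supNorm f :=
  (abs_nonneg _).trans (abs_le_supNorm f (Classical.arbitrary I))

lemma sum_mul_le_of_le {I : Type*} [Fintype I] {p f : I → ℝ} {c : ℝ} (hp : ∀ i, 0 ≤ p i)
    (hp1 : ∑ i, p i = 1) (hf : ∀ i, f i ≤ c) : ∑ i, p i * f i ≤ c :=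
  calc ∑ i, p i * f i ≤ ∑ i, p i * c :=
        Finset.sum_le_sum fun i _ => mul_le_mul_of_nonneg_left (hf i) (hp i)
    _ = c := by rw [← Finset.sum_mul, hp1, one_mul]

/-- Gibbs' inequality. -/
lemma sum_mul_log_sub_log_nonpos {I : Type*} [Fintype I] {p q : I → ℝ} (hp : ∀ i, 0 < p i)
    (hq : ∀ i, 0 < q i) (hp1 : ∑ i, p i = 1) (hq1 : ∑ i, q i = 1) :
    ∑ i, p i * (Real.log (q i) - Real.log (p i)) ≤ 0 := by
  have h : ∀ i, p i * (Real.log (q i) - Real.log (p i)) ≤ q i - p i := fun i => by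
    rw [← Real.log_div (hq i).ne' (hp i).ne']
    calc p i * Real.log (q i / p i) ≤ p i * (q i / p i - 1) :=
          mul_le_mul_of_nonneg_left (Real.log_le_sub_one_of_pos (div_pos (hq i) (hp i))) (hp i).le
      _ = q i - p i := by field_simp [(hp i).ne']
  calc _ ≤ ∑ i, (q i - p i) := Finset.sum_le_sum fun i _ => h i
    _ = 0 := by rw [Finset.sum_sub_distrib, hp1, hq1, sub_self]

/-- Maximum principle for discounted stochastic recursions. -/
lemma IsStochastic.le_div_of_le_add {S : Type*} [Fintype S] [Nonempty S] {K : Matrix S S ℝ}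
    (hK : IsStochastic K) {γ c : ℝ} (hγ0 : 0 ≤ γ) (hγ1 : γ < 1) {W : S → ℝ}
    (hW : ∀ s, W s ≤ c + γ * ∑ s', K s s' * W s') (s : S) : W s ≤ c / (1 - γ) := by
  obtain ⟨m, hm⟩ := Finite.exists_max W
  have h := sum_mul_le_of_le (hK.1 m) (hK.2 m) hm
  refine (hm s).trans ?_
  rw [le_div_iff₀ (by linarith)]
  nlinarith [hW m, mul_le_mul_of_nonneg_left h hγ0]

section MDP

variable {S A : Type*} [Fintype S] [Fintype A] {P : A → Matrix S S ℝ} {π π' : S → A → ℝ}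
  {R Q Q' : S × A → ℝ} {γ : ℝ}

lemma isStochastic_PtildeGen (hP : ∀ a, IsStochastic (P a)) (hπ : IsPolicy π) :
    IsStochastic (PtildeGen P π) := by
  refine ⟨fun s s' => Finset.sum_nonneg fun a _ => mul_nonneg (hπ.1 s a) ((hP a).1 s s'),
    fun s => ?_⟩
  simp only [PtildeGen, Matrix.of_apply]
  rw [Finset.sum_comm]
  simp [← Finset.mul_sum, (hP _).2, hπ.2]

lemma bellman_apply (hQ : Q = R + γ • (Psa P π).mulVec Q) (s : S) (a : A) :
    Q (s, a) = R (s, a) + γ * ∑ s', P a s s' * stateValue π Q s' := by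
  conv_lhs => rw [hQ]
  simp [Matrix.mulVec, dotProduct, Psa, stateValue, Fintype.sum_prod_type, Finset.mul_sum,
    mul_assoc]

lemma sum_PtildeGen_mul (f : S → ℝ) (s : S) :
    ∑ s', PtildeGen P π s s' * f s' = ∑ a, π s a * ∑ s', P a s s' * f s' := by
  simp only [PtildeGen, Matrix.of_apply, Finset.sum_mul, Finset.mul_sum, mul_assoc]
  exact Finset.sum_comm

lemma stateValue_eq (hQ : Q = R + γ • (Psa P π).mulVec Q) (s : S) :
    stateValue π Q s = ∑ a, π s a * R (s, a) +
      γ * ∑ s', PtildeGen P π s s' * stateValue π Q s' := by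
  rw [sum_PtildeGen_mul, Finset.mul_sum, ← Finset.sum_add_distrib]
  conv_lhs => rw [stateValue]
  refine Finset.sum_congr rfl fun a _ => ?_
  rw [bellman_apply hQ s a]
  ring

/-- One-step form of the performance difference lemma. -/
lemma stateValue_sub_eq (hQ : Q = R + γ • (Psa P π).mulVec Q)
    (hQ' : Q' = R + γ • (Psa P π').mulVec Q') (s : S) :
    stateValue π' Q' s - stateValue π Q s = ∑ a, (π' s a - π s a) * Q (s, a) +
      γ * ∑ s', PtildeGen P π' s s' * (stateValue π' Q' s' - stateValue π Q s') := by
  rw [sum_PtildeGen_mul, Finset.mul_sum, ← Finset.sum_add_distrib]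
  conv_lhs => rw [stateValue, stateValue, ← Finset.sum_sub_distrib]
  refine Finset.sum_congr rfl fun a _ => ?_
  simp only [mul_sub, Finset.sum_sub_distrib]
  rw [bellman_apply hQ' s a, bellman_apply hQ s a]
  ring

lemma stateValue_le [Nonempty S] (hP : ∀ a, IsStochastic (P a)) (hπ : IsPolicy π)
    (hR : ∀ x, R x ≤ 1) (hγ0 : 0 ≤ γ) (hγ1 : γ < 1) (hQ : Q = R + γ • (Psa P π).mulVec Q)
    (s : S) : stateValue π Q s ≤ 1 / (1 - γ) := by
  refine (isStochastic_PtildeGen hP hπ).le_div_of_le_add hγ0 hγ1 (fun s => ?_) s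
  rw [stateValue_eq hQ s]
  gcongr
  exact sum_mul_le_of_le (hπ.1 s) (hπ.2 s) fun a => hR _

lemma stateValue_nonneg [Nonempty S] (hP : ∀ a, IsStochastic (P a)) (hπ : IsPolicy π)
    (hR : ∀ x, 0 ≤ R x) (hγ0 : 0 ≤ γ) (hγ1 : γ < 1) (hQ : Q = R + γ • (Psa P π).mulVec Q)
    (s : S) : 0 ≤ stateValue π Q s := by
  have := (isStochastic_PtildeGen hP hπ).le_div_of_le_add (c := 0)
    (W := fun s => -stateValue π Q s) hγ0 hγ1 (fun s => ?_) s
  · simpa using this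
  · have h : 0 ≤ ∑ a, π s a * R (s, a) :=
      Finset.sum_nonneg fun a _ => mul_nonneg (hπ.1 s a) (hR _)
    simp only [mul_neg, Finset.sum_neg_distrib]
    linarith [stateValue_eq hQ s]

end MDP

section NPG

variable {S A : Type*} [Fintype A] {π p p' : S → A → ℝ} {Q Q' : S × A → ℝ} {β : ℝ}

lemma sum_sub_mul_le (hp : IsPolicy p) (hp' : IsPolicy p') {δ : ℝ}
    (hδ : ∀ x, |Q x - Q' x| ≤ δ) (s : S) :
    ∑ a, (p s a - p' s a) * Q (s, a) ≤ ∑ a, (p s a - p' s a) * Q' (s, a) + 2 * δ := by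
  have h1 : ∑ a, p s a * (Q (s, a) - Q' (s, a)) ≤ δ :=
    sum_mul_le_of_le (hp.1 s) (hp.2 s) fun a => (abs_le.1 (hδ _)).2
  have h2 : ∑ a, p' s a * (Q' (s, a) - Q (s, a)) ≤ δ :=
    sum_mul_le_of_le (hp'.1 s) (hp'.2 s) fun a => by linarith [(abs_le.1 (hδ (s, a))).1]
  simp only [mul_sub, sub_mul, Finset.sum_sub_distrib] at *
  linarith

variable [Nonempty A]

lemma npg_denom_pos (hpos : ∀ s a, 0 < π s a) (s : S) :
    0 < ∑ a, π s a * Real.exp (β * Q (s, a)) :=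
  Finset.sum_pos (fun a _ => mul_pos (hpos s a) (Real.exp_pos _)) Finset.univ_nonempty

lemma npg_pos (hpos : ∀ s a, 0 < π s a) (s : S) (a : A) : 0 < npg π β Q s a :=
  div_pos (mul_pos (hpos s a) (Real.exp_pos _)) (npg_denom_pos hpos s)

lemma npg_sum (hpos : ∀ s a, 0 < π s a) (s : S) : ∑ a, npg π β Q s a = 1 := by
  simp only [npg]
  rw [← Finset.sum_div, div_self (npg_denom_pos hpos s).ne']

lemma isPolicy_npg (hpos : ∀ s a, 0 < π s a) : IsPolicy (npg π β Q) :=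
  ⟨fun s a => (npg_pos hpos s a).le, npg_sum hpos⟩

lemma log_npg (hpos : ∀ s a, 0 < π s a) (s : S) (a : A) :
    β * Q (s, a) = Real.log (npg π β Q s a) - Real.log (π s a) +
      Real.log (∑ a', π s a' * Real.exp (β * Q (s, a'))) := by
  rw [npg, Real.log_div (mul_pos (hpos s a) (Real.exp_pos _)).ne' (npg_denom_pos hpos s).ne',
    Real.log_mul (hpos s a).ne' (Real.exp_pos _).ne', Real.log_exp]
  ring

lemma mul_sum_npg (hpos : ∀ s a, 0 < π s a) (hp : IsPolicy p) (s : S) :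
    β * ∑ a, p s a * Q (s, a) =
      ∑ a, p s a * (Real.log (npg π β Q s a) - Real.log (π s a)) +
        Real.log (∑ a, π s a * Real.exp (β * Q (s, a))) := by
  set z := Real.log (∑ a, π s a * Real.exp (β * Q (s, a))) with hz
  calc β * ∑ a, p s a * Q (s, a) = ∑ a, (p s a * (Real.log (npg π β Q s a) - Real.log (π s a))
        + p s a * z) := by
        rw [Finset.mul_sum]
        refine Finset.sum_congr rfl fun a _ => ?_
        rw [← mul_add, hz, ← log_npg hpos s a]
        ring
    _ = _ := by rw [Finset.sum_add_distrib, ← Finset.sum_mul, hp.2, one_mul]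

lemma log_denom_le_npg (hpos : ∀ s a, 0 < π s a) (s : S) (hπ : IsPolicy π) :
    Real.log (∑ a, π s a * Real.exp (β * Q (s, a))) ≤ β * ∑ a, npg π β Q s a * Q (s, a) := by
  have h := sum_mul_log_sub_log_nonpos (npg_pos (β := β) (Q := Q) hpos s) (hpos s)
    (npg_sum hpos s) (hπ.2 s)
  rw [mul_sum_npg hpos (isPolicy_npg hpos) s]
  simp only [mul_sub, Finset.sum_sub_distrib] at *
  linarith

/-- The NPG update does not decrease the one-step expectation of `Q`. -/
lemma npg_improves (hβ : 0 < β) (hpos : ∀ s a, 0 < π s a) (hπ : IsPolicy π) (s : S) :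
    0 ≤ ∑ a, (npg π β Q s a - π s a) * Q (s, a) := by
  have h := sum_mul_log_sub_log_nonpos (hpos s) (npg_pos (β := β) (Q := Q) hpos s)
    (hπ.2 s) (npg_sum hpos s)
  have h1 := log_denom_le_npg (β := β) (Q := Q) hpos s hπ
  have h2 := mul_sum_npg (β := β) (Q := Q) hpos hπ s
  simp only [sub_mul, Finset.sum_sub_distrib]
  have : β * ∑ a, π s a * Q (s, a) ≤ β * ∑ a, npg π β Q s a * Q (s, a) := by linarith
  linarith [le_of_mul_le_mul_left this hβ]

lemma npg_regret_le (hβ : 0 < β) (hpos : ∀ s a, 0 < π s a) (hπ : IsPolicy π) (hp : IsPolicy p)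
    (s : S) :
    ∑ a, (p s a - π s a) * Q (s, a) ≤
      (∑ a, p s a * (Real.log (npg π β Q s a) - Real.log (π s a))) / β +
        ∑ a, (npg π β Q s a - π s a) * Q (s, a) := by
  have h1 := log_denom_le_npg (β := β) (Q := Q) hpos s hπ
  have h2 := mul_sum_npg (β := β) (Q := Q) hpos hp s
  have h3 : ∑ a, p s a * Q (s, a) ≤
      (∑ a, p s a * (Real.log (npg π β Q s a) - Real.log (π s a))) / β +
        ∑ a, npg π β Q s a * Q (s, a) := by
    rw [← sub_le_iff_le_add, le_div_iff₀ hβ]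
    linarith
  simp only [sub_mul, Finset.sum_sub_distrib] at *
  linarith

end NPG

/-- Approximate policy improvement: the one-step gain of an NPG update is controlled by the gain
in value, up to the critic error. -/
lemma npg_gain_le {S A : Type*} [Fintype S] [Fintype A] [Nonempty S] [Nonempty A]
    {P : A → Matrix S S ℝ} (hP : ∀ a, IsStochastic (P a)) {R Q Q' Qh : S × A → ℝ}
    {π : S → A → ℝ} {γ β δ : ℝ} (hγ0 : 0 ≤ γ) (hγ1 : γ < 1) (hβ : 0 < β)
    (hpos : ∀ s a, 0 < π s a) (hπ : IsPolicy π)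
    (hQ : Q = R + γ • (Psa P π).mulVec Q)
    (hQ' : Q' = R + γ • (Psa P (npg π β Qh)).mulVec Q')
    (hδ : ∀ x, |Q x - Qh x| ≤ δ) (s : S) :
    ∑ a, (npg π β Qh s a - π s a) * Q (s, a) ≤
      stateValue (npg π β Qh) Q' s - stateValue π Q s + γ * (2 * δ / (1 - γ)) := by
  have hK := isStochastic_PtildeGen hP (isPolicy_npg (β := β) (Q := Qh) hpos)
  have hdiff := stateValue_sub_eq hQ hQ'
  have hδ' : ∀ x, |Qh x - Q x| ≤ δ := fun x => abs_sub_comm (Q x) (Qh x) ▸ hδ x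
  have hlow : ∀ s, stateValue π Q s - stateValue (npg π β Qh) Q' s ≤ 2 * δ / (1 - γ) := by
    refine hK.le_div_of_le_add hγ0 hγ1 fun s => ?_
    have h1 := sum_sub_mul_le (isPolicy_npg (β := β) (Q := Qh) hpos) hπ hδ' s
    have h2 := npg_improves (Q := Qh) hβ hpos hπ s
    have h3 := hdiff s
    simp only [mul_sub, Finset.sum_sub_distrib] at *
    linarith
  have h := mul_le_mul_of_nonneg_left (sum_mul_le_of_le (hK.1 s) (hK.2 s) hlow) hγ0
  have h3 := hdiff s
  simp only [mul_sub, Finset.sum_sub_distrib] at *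
  linarith

/-- For the NPG/NAC iteration started from the uniform policy with
stepsize `β ∈ (0,1]` and arbitrary critic estimates `Q_1, …, Q_T`:
`V^{π*}(μ) − max_{0 ≤ t ≤ T−1} V^{π_t}(μ) ≤ log(e|A|)/((1−γ)² β T)
  + (4/((1−γ)² T)) Σ_{t=0}^{T−1} ‖Q^{π_t} − Q_{t+1}‖_∞`. -/
theorem nac_actor_performance_bound
    {S A : Type*} [Fintype S] [Fintype A] [Nonempty S] [Nonempty A]
    (P : A → Matrix S S ℝ) (hP : ∀ a, IsStochastic (P a))
    (R : S × A → ℝ) (hR : ∀ x, 0 ≤ R x ∧ R x ≤ 1)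
    (γ : ℝ) (hγ0 : 0 < γ) (hγ1 : γ < 1)
    (T : ℕ) (hT : 1 ≤ T)
    (β : ℝ) (hβ0 : 0 < β) (hβ1 : β ≤ 1)
    (Qs : ℕ → S × A → ℝ)
    (πseq : ℕ → S → A → ℝ)
    (hπ0 : ∀ s a, πseq 0 s a = 1 / (Fintype.card A : ℝ))
    (hup : ∀ t < T, πseq (t + 1) = npg (πseq t) β (Qs (t + 1)))
    (Qpis : ℕ → S × A → ℝ)
    (hQpis : ∀ t, Qpis t = R + γ • (Psa P (πseq t)).mulVec (Qpis t))
    (πstar : S → A → ℝ) (hπstar : IsPolicy πstar)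
    (Qstar : S × A → ℝ) (hQstar : Qstar = R + γ • (Psa P πstar).mulVec Qstar)
    (μ : S → ℝ) (hμ0 : ∀ s, 0 ≤ μ s) (hμ1 : ∑ s, μ s = 1) :
    (∑ s, μ s * (∑ a, πstar s a * Qstar (s, a))) -
      (Finset.range T).sup' (Finset.nonempty_range_iff.mpr (by omega))
        (fun t => ∑ s, μ s * (∑ a, πseq t s a * Qpis t (s, a))) ≤
      Real.log (Real.exp 1 * (Fintype.card A : ℝ)) / ((1 - γ) ^ 2 * β * T)
        + (4 / ((1 - γ) ^ 2 * T)) *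
            ∑ t ∈ Finset.range T, supNorm (Qpis t - Qs (t + 1)) := by
  have hcard : (0 : ℝ) < Fintype.card A := by exact_mod_cast Fintype.card_pos
  have hγ : 0 < 1 - γ := by linarith
  have hTpos : (0 : ℝ) < T := by exact_mod_cast hT
  have hpol : ∀ t ≤ T, (∀ s a, 0 < πseq t s a) ∧ IsPolicy (πseq t) := by
    intro t
    induction t with
    | zero =>
      intro _
      have hpos : ∀ s a, 0 < πseq 0 s a := fun s a => by rw [hπ0]; positivity
      refine ⟨hpos, fun s a => (hpos s a).le, fun s => ?_⟩
      simp [hπ0, hcard.ne']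
    | succ t ih =>
      intro ht
      have hpos := (ih (by omega)).1
      rw [hup t (by omega)]
      exact ⟨npg_pos hpos, isPolicy_npg hpos⟩
  set δ : ℕ → ℝ := fun t => supNorm (Qpis t - Qs (t + 1))
  have hδ : ∀ t x, |Qpis t x - Qs (t + 1) x| ≤ δ t := fun t x =>
    abs_le_supNorm (Qpis t - Qs (t + 1)) x
  set V : ℕ → S → ℝ := fun t => stateValue (πseq t) (Qpis t) with hV
  set L : ℕ → S → ℝ := fun t s => ∑ a, πstar s a * Real.log (πseq t s a) with hL
  have hstep : ∀ t < T, ∀ s, ∑ a, (πstar s a - πseq t s a) * Qpis t (s, a) ≤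
      (L (t + 1) s - L t s) / β + (V (t + 1) s - V t s) + 4 / (1 - γ) * δ t := by
    intro t ht s
    obtain ⟨hpos, hπ⟩ := hpol t ht.le
    have hQ' := hQpis (t + 1)
    have h1 := sum_sub_mul_le hπstar hπ (hδ t) s
    have h2 := npg_regret_le (Q := Qs (t + 1)) hβ0 hpos hπ hπstar s
    rw [hup t ht] at hQ'
    have h3 := sum_sub_mul_le (isPolicy_npg (β := β) (Q := Qs (t + 1)) hpos) hπ
      (fun x => abs_sub_comm (Qpis t x) (Qs (t + 1) x) ▸ hδ t x) s
    have h4 := npg_gain_le hP hγ0.le hγ1 hβ0 hpos hπ (hQpis t) hQ' (hδ t) s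
    rw [← hup t ht] at h2 h3 h4
    have h5 : 2 * δ t + 2 * δ t + γ * (2 * δ t / (1 - γ)) ≤ 4 / (1 - γ) * δ t := by
      have : 4 / (1 - γ) * δ t - (2 * δ t + 2 * δ t + γ * (2 * δ t / (1 - γ))) =
          2 * γ * δ t / (1 - γ) := by
        field_simp
        ring
      have : 0 ≤ 2 * γ * δ t / (1 - γ) :=
        div_nonneg (mul_nonneg (by linarith) (supNorm_nonneg _)) hγ.le
      linarith
    have h6 : ∑ a, πstar s a * (Real.log (πseq (t + 1) s a) - Real.log (πseq t s a)) =
        L (t + 1) s - L t s := by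
      simp only [hL, mul_sub, Finset.sum_sub_distrib]
    rw [h6] at h2
    simp only [hV]
    linarith
  set c : ℝ := Real.log (Fintype.card A) / β + 1 / (1 - γ) +
    4 / (1 - γ) * ∑ t ∈ Finset.range T, δ t with hc
  have hregret : ∀ s, ∑ t ∈ Finset.range T, ∑ a, (πstar s a - πseq t s a) * Qpis t (s, a) ≤ c := by
    intro s
    have h1 := Finset.sum_le_sum fun t ht => hstep t (Finset.mem_range.1 ht) s
    rw [Finset.sum_add_distrib, Finset.sum_add_distrib, ← Finset.sum_div, ← Finset.mul_sum,
      Finset.sum_range_sub (fun t => L t s), Finset.sum_range_sub (fun t => V t s)] at h1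
    have hLT : L T s ≤ 0 := sum_mul_le_of_le (hπstar.1 s) (hπstar.2 s) fun a => by
      have hT' := (hpol T le_rfl).2
      refine Real.log_nonpos (hT'.1 s a) ?_
      rw [← hT'.2 s]
      exact Finset.single_le_sum (fun a _ => hT'.1 s a) (Finset.mem_univ a)
    have hL0 : L 0 s = -Real.log (Fintype.card A) := by
      simp [hL, hπ0, ← Finset.sum_mul, hπstar.2]
    have hVT : V T s ≤ 1 / (1 - γ) := stateValue_le hP (hpol T le_rfl).2 (fun x => (hR x).2)
      hγ0.le hγ1 (hQpis T) s
    have hV0 : 0 ≤ V 0 s := stateValue_nonneg hP (hpol 0 (by omega)).2 (fun x => (hR x).1)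
      hγ0.le hγ1 (hQpis 0) s
    have : (L T s - L 0 s) / β ≤ Real.log (Fintype.card A) / β :=
      div_le_div_of_nonneg_right (by linarith) hβ0.le
    linarith
  have hgap : ∀ s, ∑ t ∈ Finset.range T, (stateValue πstar Qstar s - V t s) ≤ c / (1 - γ) := by
    refine (isStochastic_PtildeGen hP hπstar).le_div_of_le_add hγ0.le hγ1 fun s => ?_
    simp only [Finset.mul_sum]
    rw [Finset.sum_comm]
    simp only [← Finset.mul_sum]
    calc _ = ∑ t ∈ Finset.range T, (∑ a, (πstar s a - πseq t s a) * Qpis t (s, a) +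
          γ * ∑ s', PtildeGen P πstar s s' * (stateValue πstar Qstar s' - V t s')) :=
          Finset.sum_congr rfl fun t _ => stateValue_sub_eq (hQpis t) hQstar s
      _ ≤ _ := by
          rw [Finset.sum_add_distrib, ← Finset.mul_sum]
          gcongr
          exact hregret s
  have hmean := sum_mul_le_of_le hμ0 hμ1 hgap
  set M := (Finset.range T).sup' (Finset.nonempty_range_iff.mpr (by omega))
    (fun t => ∑ s, μ s * (∑ a, πseq t s a * Qpis t (s, a)))
  have hmax : ∀ t ∈ Finset.range T, ∑ s, μ s * V t s ≤ M := fun t ht =>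
    Finset.le_sup' (fun t => ∑ s, μ s * (∑ a, πseq t s a * Qpis t (s, a))) ht
  have hsum : T * ((∑ s, μ s * stateValue πstar Qstar s) - M) ≤ c / (1 - γ) := by
    refine le_trans ?_ hmean
    simp only [Finset.mul_sum]
    rw [Finset.sum_comm]
    calc T * ((∑ s, μ s * stateValue πstar Qstar s) - M)
        = ∑ t ∈ Finset.range T, ((∑ s, μ s * stateValue πstar Qstar s) - M) := by simp [mul_sub]
      _ ≤ _ := Finset.sum_le_sum fun t ht => by
          simp only [mul_sub, Finset.sum_sub_distrib]
          linarith [hmax t ht]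
  have hlog : Real.log (Real.exp 1 * (Fintype.card A : ℝ)) = 1 + Real.log (Fintype.card A) := by
    rw [Real.log_mul (Real.exp_pos _).ne' hcard.ne', Real.log_exp]
  have hlog0 : 0 ≤ Real.log (Fintype.card A) :=
    Real.log_nonneg (by exact_mod_cast Fintype.card_pos)
  have hc' : c ≤ (1 + Real.log (Fintype.card A)) / ((1 - γ) * β) +
      4 / (1 - γ) * ∑ t ∈ Finset.range T, δ t := by
    have h1 : Real.log (Fintype.card A) / β ≤ Real.log (Fintype.card A) / ((1 - γ) * β) :=
      div_le_div_of_nonneg_left hlog0 (by positivity) (by nlinarith)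
    have h2 : 1 / (1 - γ) ≤ 1 / ((1 - γ) * β) :=
      div_le_div_of_nonneg_left zero_le_one (by positivity) (by nlinarith)
    rw [hc, add_div]
    linarith
  calc (∑ s, μ s * stateValue πstar Qstar s) - M ≤ c / (1 - γ) / T := by
        rw [le_div_iff₀ hTpos]
        linarith
    _ ≤ ((1 + Real.log (Fintype.card A)) / ((1 - γ) * β) +
          4 / (1 - γ) * ∑ t ∈ Finset.range T, δ t) / (1 - γ) / T := by gcongr
    _ = _ := by
        rw [hlog]
        field_simp
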